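/- arXiv:2206.00479 — 4 statements merged into one kernel-verified Lean document; each statement's English description precedes it below -/
import Mathlib

section
/- Let m ≥ 1, p ∈ [1,∞), let (Ω_n)_{n∈ℕ} be a sequence of measurable subsets of ℝ^m with 0 < |Ω_n| < ∞, and for each n let f_n : Ω_n → ℝ be measurable with 0 < ‖f_n‖_{L^p(Ω_n)} < ∞. Then the supremum defining κ is attained: there exists a sequence (A_n) of measurable sets A_n ⊆ Ω_n with lim_{n→∞} |A_n|/|Ω_n| = 0 such that limsup_{n→∞} ‖f_n 1_{A_n}‖_{L^p}^p / ‖f_n‖_{L^p}^p = κ. -/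
open MeasureTheory Filter

/-- The supremum defining `κ` is attained by a maximising sequence `(A_n)`. -/
theorem kappa_sup_attained
    {m : ℕ} (hm : 1 ≤ m) (p : ℝ) (hp : 1 ≤ p)
    (Ω : ℕ → Set (Fin m → ℝ)) (hΩmeas : ∀ n, MeasurableSet (Ω n))
    (hΩpos : ∀ n, 0 < volume (Ω n)) (hΩfin : ∀ n, volume (Ω n) < ⊤)
    (f : ℕ → (Fin m → ℝ) → ℝ) (hfmeas : ∀ n, Measurable (f n))
    (hfLp : ∀ n, IntegrableOn (fun x => |f n x| ^ p) (Ω n) volume)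
    (hfpos : ∀ n, 0 < ∫ x in Ω n, |f n x| ^ p) :
    ∃ A : ℕ → Set (Fin m → ℝ),
      (∀ n, MeasurableSet (A n)) ∧ (∀ n, A n ⊆ Ω n) ∧
      Tendsto (fun n => (volume (A n)).toReal / (volume (Ω n)).toReal)
        atTop (nhds 0) ∧
      limsup (fun n =>
          (∫ x in A n, |f n x| ^ p) / (∫ x in Ω n, |f n x| ^ p)) atTop
        = sSup {r : ℝ | ∃ B : ℕ → Set (Fin m → ℝ),
            (∀ n, MeasurableSet (B n)) ∧ (∀ n, B n ⊆ Ω n) ∧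
            Tendsto (fun n => (volume (B n)).toReal / (volume (Ω n)).toReal)
              atTop (nhds 0) ∧
            r = limsup (fun n =>
                (∫ x in B n, |f n x| ^ p) / (∫ x in Ω n, |f n x| ^ p)) atTop} := by
  set H : ℕ → Set (Fin m → ℝ) → ℝ := fun n B =>
    (∫ x in B, |f n x| ^ p) / (∫ x in Ω n, |f n x| ^ p) with hH
  set G : ℕ → Set (Fin m → ℝ) → ℝ := fun n B =>
    (volume B).toReal / (volume (Ω n)).toReal with hG
  have hG0 : ∀ n B, 0 ≤ G n B := fun n B => by simp only [hG]; positivity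
  have hH0 : ∀ n B, 0 ≤ H n B := fun n B =>
    div_nonneg (integral_nonneg fun x => Real.rpow_nonneg (abs_nonneg _) _) (hfpos n).le
  have hH1 : ∀ n B, B ⊆ Ω n → H n B ≤ 1 := fun n B hB => by
    refine (div_le_one (hfpos n)).2 ?_
    exact setIntegral_mono_set (hfLp n)
      (Eventually.of_forall fun x => Real.rpow_nonneg (abs_nonneg _) _) hB.eventuallyLE
  set S : Set ℝ := {r : ℝ | ∃ B : ℕ → Set (Fin m → ℝ),
            (∀ n, MeasurableSet (B n)) ∧ (∀ n, B n ⊆ Ω n) ∧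
            Tendsto (fun n => G n (B n)) atTop (nhds 0) ∧
            r = limsup (fun n => H n (B n)) atTop} with hS
  change ∃ A : ℕ → Set (Fin m → ℝ),
      (∀ n, MeasurableSet (A n)) ∧ (∀ n, A n ⊆ Ω n) ∧
      Tendsto (fun n => G n (A n)) atTop (nhds 0) ∧
      limsup (fun n => H n (A n)) atTop = sSup S
  have hbdd : ∀ B : ℕ → Set (Fin m → ℝ), (∀ n, B n ⊆ Ω n) →
      IsBoundedUnder (· ≤ ·) atTop (fun n => H n (B n)) := fun B hB =>
    isBoundedUnder_of ⟨1, fun n => hH1 n _ (hB n)⟩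
  have hcob : ∀ B : ℕ → Set (Fin m → ℝ),
      IsCoboundedUnder (· ≤ ·) atTop (fun n => H n (B n)) := fun B =>
    (isBoundedUnder_of ⟨0, fun n => hH0 n _⟩ :
      IsBoundedUnder (· ≥ ·) atTop (fun n => H n (B n))).isCoboundedUnder_le
  have hSb : BddAbove S := by
    refine ⟨1, ?_⟩
    rintro r ⟨B, -, hB, -, rfl⟩
    exact limsup_le_of_le (hcob B) (Eventually.of_forall fun n => hH1 n _ (hB n))
  have hSn : S.Nonempty :=
    ⟨_, fun _ => ∅, fun _ => MeasurableSet.empty, fun _ => Set.empty_subset _, by simp [hG], rfl⟩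
  have hfreq : ∀ k : ℕ, ∃ᶠ n in atTop, ∃ B : Set (Fin m → ℝ), MeasurableSet B ∧ B ⊆ Ω n ∧
      G n B < 1 / ((k : ℝ) + 1) ∧ sSup S - 1 / ((k : ℝ) + 1) < H n B := by
    intro k
    have hk : (0 : ℝ) < 1 / ((k : ℝ) + 1) := by positivity
    obtain ⟨r, ⟨B, hBm, hB, hBt, rfl⟩, hr⟩ :=
      exists_lt_of_lt_csSup hSn (sub_lt_self (sSup S) hk)
    have h1 := frequently_lt_of_lt_limsup (hcob B) hr
    exact (h1.and_eventually (hBt.eventually_lt_const hk)).mono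
      fun n hn => ⟨B n, hBm n, hB n, hn.2, hn.1⟩
  obtain ⟨φ, hφ, hC⟩ := extraction_forall_of_frequently hfreq
  choose C hCm hCs hCG hCH using hC
  have hA1 : ∀ k, Function.extend φ C (fun _ => ∅) (φ k) = C k := fun k =>
    hφ.injective.extend_apply _ _ _
  have hA2 : ∀ n, (¬ ∃ k, φ k = n) → Function.extend φ C (fun _ => ∅) n = ∅ := fun n hn =>
    Function.extend_apply' _ _ _ hn
  generalize Function.extend φ C (fun _ => ∅) = A at hA1 hA2
  have hAm : ∀ n, MeasurableSet (A n) := fun n => by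
    by_cases h : ∃ k, φ k = n
    · obtain ⟨k, rfl⟩ := h
      rw [hA1]; exact hCm k
    · rw [hA2 n h]; exact MeasurableSet.empty
  have hAs : ∀ n, A n ⊆ Ω n := fun n => by
    by_cases h : ∃ k, φ k = n
    · obtain ⟨k, rfl⟩ := h
      rw [hA1]; exact hCs k
    · rw [hA2 n h]; exact Set.empty_subset _
  have hAt : Tendsto (fun n => G n (A n)) atTop (nhds 0) := by
    refine tendsto_order.2 ⟨fun a ha => Eventually.of_forall fun n => ha.trans_le (hG0 n _),
      fun a ha => ?_⟩
    obtain ⟨K, hK⟩ := exists_nat_one_div_lt ha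
    filter_upwards [eventually_ge_atTop (φ K)] with n hn
    by_cases h : ∃ k, φ k = n
    · obtain ⟨k, rfl⟩ := h
      rw [hA1]
      have hKk : K ≤ k := hφ.le_iff_le.1 hn
      exact ((hCG k).trans_le (one_div_le_one_div_of_le (by positivity) (by gcongr))).trans hK
    · rw [hA2 n h]; simpa [hG] using ha
  refine ⟨A, hAm, hAs, hAt, le_antisymm (le_csSup hSb ⟨A, hAm, hAs, hAt, rfl⟩) ?_⟩
  refine le_of_forall_lt_imp_le_of_dense fun c hc => ?_
  refine le_limsup_of_frequently_le ?_ (hbdd A hAs)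
  obtain ⟨K, hK⟩ := exists_nat_one_div_lt (sub_pos.2 hc)
  have hev : ∀ᶠ k in atTop, c ≤ H (φ k) (A (φ k)) := by
    filter_upwards [eventually_ge_atTop K] with k hk
    rw [hA1]
    have h1 := hCH k
    have h2 : 1 / ((k : ℝ) + 1) ≤ 1 / ((K : ℝ) + 1) :=
      one_div_le_one_div_of_le (by positivity) (by gcongr)
    linarith
  exact hφ.tendsto_atTop.frequently hev.frequently
end

section
/- Let m ≥ 1, let (Ω_n)_{n∈ℕ} be measurable subsets of ℝ^m with 0 < |Ω_n| < ∞, let λ_n > 0, and let u_n : Ω_n → ℝ be measurable with ∫_{Ω_n} u_n² = 1 and ‖u_n‖_{L^∞(Ω_n)} ≤ (e/(2πm))^{m/4} λ_n^{m/4} for every n. If there exists a sequence (A_n) of measurable sets A_n ⊆ Ω_n with lim_{n→∞} |A_n|/|Ω_n| = 0 and lim_{n→∞} ∫_{A_n} u_n² = 1, then lim_{n→∞} λ_n |Ω_n|^{2/m} = +∞. -/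
open MeasureTheory Real Filter

/-- If `L²`-normalised functions `u_n` satisfying the eigenfunction sup-norm bound
localise in `L²` (mass concentrates on sets of vanishing relative measure), then
`λ_n |Ω_n|^{2/m} → ∞`. -/
theorem eigenvalue_blowup_of_localisation
    {m : ℕ} (hm : 1 ≤ m)
    (Ω : ℕ → Set (Fin m → ℝ)) (hΩmeas : ∀ n, MeasurableSet (Ω n))
    (hΩpos : ∀ n, 0 < volume (Ω n)) (hΩfin : ∀ n, volume (Ω n) < ⊤)
    (lam : ℕ → ℝ) (hlam : ∀ n, 0 < lam n)
    (u : ℕ → (Fin m → ℝ) → ℝ) (humeas : ∀ n, Measurable (u n))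
    (hnorm : ∀ n, ∫ x in Ω n, (u n x) ^ 2 = 1)
    (hsup : ∀ n, eLpNorm (u n) ⊤ (volume.restrict (Ω n))
      ≤ ENNReal.ofReal ((exp 1 / (2 * π * m)) ^ ((m : ℝ) / 4) * lam n ^ ((m : ℝ) / 4)))
    (A : ℕ → Set (Fin m → ℝ)) (hAmeas : ∀ n, MeasurableSet (A n))
    (hAΩ : ∀ n, A n ⊆ Ω n)
    (hAvol : Tendsto (fun n => (volume (A n)).toReal / (volume (Ω n)).toReal)
      atTop (nhds 0))
    (hAmass : Tendsto (fun n => ∫ x in A n, (u n x) ^ 2) atTop (nhds 1)) :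
    Tendsto (fun n => lam n * (volume (Ω n)).toReal ^ (2 / (m : ℝ))) atTop atTop := by
  have hm0 : (0 : ℝ) < m := by exact_mod_cast hm
  set c : ℝ := exp 1 / (2 * π * m) with hc
  have hc0 : 0 < c := by positivity
  have key : ∀ n, ∫ x in A n, (u n x) ^ 2 ≤
      c ^ ((m : ℝ) / 2) * (lam n * (volume (Ω n)).toReal ^ (2 / (m : ℝ))) ^ ((m : ℝ) / 2)
        * ((volume (A n)).toReal / (volume (Ω n)).toReal) := by
    intro n
    have hl := hlam n
    have hV : 0 < (volume (Ω n)).toReal :=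
      ENNReal.toReal_pos (hΩpos n).ne' (hΩfin n).ne
    have hAfin : volume (A n) < ⊤ := (measure_mono (hAΩ n)).trans_lt (hΩfin n)
    set M : ℝ := c ^ ((m : ℝ) / 4) * lam n ^ ((m : ℝ) / 4) with hM
    have hM0 : 0 ≤ M := by positivity
    have hae : ∀ᵐ x ∂(volume.restrict (A n)), ‖(u n x) ^ 2‖ ≤ M ^ 2 := by
      apply ae_restrict_of_ae_restrict_of_subset (hAΩ n)
      have h1 := hsup n
      rw [eLpNorm_exponent_top] at h1
      filter_upwards [enorm_ae_le_eLpNormEssSup (u n) (volume.restrict (Ω n))] with x hx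
      have h2 := hx.trans h1
      rw [← ofReal_norm_eq_enorm, ENNReal.ofReal_le_ofReal_iff hM0] at h2
      rw [norm_pow]
      gcongr
    have hb := norm_setIntegral_le_of_norm_le_const_ae hAfin hae
    have hM2 : M ^ 2 = c ^ ((m : ℝ) / 2) * lam n ^ ((m : ℝ) / 2) := by
      rw [hM, mul_pow, ← rpow_mul_natCast hc0.le, ← rpow_mul_natCast hl.le]
      congr 2 <;> push_cast <;> ring
    have hy : (lam n * (volume (Ω n)).toReal ^ (2 / (m : ℝ))) ^ ((m : ℝ) / 2)
        = lam n ^ ((m : ℝ) / 2) * (volume (Ω n)).toReal := by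
      rw [mul_rpow hl.le (by positivity), ← rpow_mul hV.le]
      have : 2 / (m : ℝ) * ((m : ℝ) / 2) = 1 := by field_simp
      rw [this, rpow_one]
    calc _ ≤ M ^ 2 * (volume (A n)).toReal := (le_abs_self _).trans hb
      _ = _ := by
        rw [hy, hM2]
        field_simp
  rw [tendsto_atTop]
  intro b
  have h0 := hAvol.const_mul (c ^ ((m : ℝ) / 2) * b ^ ((m : ℝ) / 2))
  rw [mul_zero] at h0
  filter_upwards [h0.eventually_lt hAmass one_pos] with n hn
  by_contra! hlt
  have hpos : 0 ≤ lam n * (volume (Ω n)).toReal ^ (2 / (m : ℝ)) :=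
    mul_nonneg (hlam n).le (by positivity)
  have h3 := key n
  have h4 : c ^ ((m : ℝ) / 2) * (lam n * (volume (Ω n)).toReal ^ (2 / (m : ℝ))) ^ ((m : ℝ) / 2)
        * ((volume (A n)).toReal / (volume (Ω n)).toReal) ≤ c ^ ((m : ℝ) / 2) * b ^ ((m : ℝ) / 2)
        * ((volume (A n)).toReal / (volume (Ω n)).toReal) := by
    gcongr
  linarith
end

section
/- Let m ≥ 1, let (Ω_n)_{n∈ℕ} be nonempty open proper subsets of ℝ^m with 0 < |Ω_n| < ∞ and 0 < sup_{Ω_n} d_{Ω_n} < ∞, let 𝔠 > 0 and Λ > 0, let λ_n > 0, and let u_n : Ω_n → ℝ be measurable with ∫_{Ω_n} u_n² = 1 and ∫_{Ω_n} u_n²/d_{Ω_n}² ≤ 𝔠 · λ_n for every n (uniform Hardy bound), and λ_n · (sup_{Ω_n} d_{Ω_n})² ≤ Λ for every n. If (A_n) is a sequence of measurable sets A_n ⊆ Ω_n with lim_{n→∞} |A_n|/|Ω_n| = 1 and lim_{n→∞} (sup_{A_n} d_{Ω_n})/(sup_{Ω_n} d_{Ω_n}) = 0, then lim_{n→∞}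 ∫_{A_n} u_n² = 0; consequently the sets B_n := Ω_n \ A_n satisfy lim_{n→∞} |B_n|/|Ω_n| = 0 and lim_{n→∞} ∫_{B_n} u_n² = 1, i.e. (u_n) localises in L². -/
open MeasureTheory Metric Filter

/-- Theorem 3 of the paper (abstract form): under a uniform Hardy bound
`∫ u_n²/d² ≤ 𝔠 λ_n` and the eigenvalue bound `λ_n (sup_{Ω_n} d)² ≤ Λ`, if
`A_n ⊆ Ω_n` with `|A_n|/|Ω_n| → 1` and `sup_{A_n} d / sup_{Ω_n} d → 0`,
then `∫_{A_n} u_n² → 0`; consequently `(u_n)` localises in `L²` along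
`B_n = Ω_n \ A_n`. -/
theorem localisation_of_uniform_hardy
    {m : ℕ} (hm : 1 ≤ m)
    (Ω : ℕ → Set (EuclideanSpace ℝ (Fin m)))
    (hΩopen : ∀ n, IsOpen (Ω n)) (hΩne : ∀ n, (Ω n).Nonempty)
    (hΩproper : ∀ n, Ω n ≠ Set.univ)
    (hΩpos : ∀ n, 0 < volume (Ω n)) (hΩfin : ∀ n, volume (Ω n) < ⊤)
    (hdbdd : ∀ n, BddAbove ((fun x => infDist x (Ω n)ᶜ) '' Ω n))
    (hdpos : ∀ n, 0 < ⨆ x ∈ Ω n, infDist x (Ω n)ᶜ)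
    (𝔠 Λ : ℝ) (h𝔠 : 0 < 𝔠) (hΛ : 0 < Λ)
    (lam : ℕ → ℝ) (hlam : ∀ n, 0 < lam n)
    (u : ℕ → EuclideanSpace ℝ (Fin m) → ℝ) (humeas : ∀ n, Measurable (u n))
    (huint : ∀ n, IntegrableOn (fun x => (u n x) ^ 2) (Ω n) volume)
    (hnorm : ∀ n, ∫ x in Ω n, (u n x) ^ 2 = 1)
    (hhardyint : ∀ n,
      IntegrableOn (fun x => (u n x) ^ 2 / (infDist x (Ω n)ᶜ) ^ 2) (Ω n) volume)
    (hhardy : ∀ n, ∫ x in Ω n, (u n x) ^ 2 / (infDist x (Ω n)ᶜ) ^ 2 ≤ 𝔠 * lam n)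
    (heig : ∀ n, lam n * (⨆ x ∈ Ω n, infDist x (Ω n)ᶜ) ^ 2 ≤ Λ)
    (A : ℕ → Set (EuclideanSpace ℝ (Fin m)))
    (hAmeas : ∀ n, MeasurableSet (A n)) (hAΩ : ∀ n, A n ⊆ Ω n)
    (hAvol : Tendsto (fun n => (volume (A n)).toReal / (volume (Ω n)).toReal)
      atTop (nhds 1))
    (hAd : Tendsto (fun n =>
        (⨆ x ∈ A n, infDist x (Ω n)ᶜ) / (⨆ x ∈ Ω n, infDist x (Ω n)ᶜ))
      atTop (nhds 0)) :
    Tendsto (fun n => ∫ x in A n, (u n x) ^ 2) atTop (nhds 0) ∧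
    Tendsto (fun n => (volume (Ω n \ A n)).toReal / (volume (Ω n)).toReal)
      atTop (nhds 0) ∧
    Tendsto (fun n => ∫ x in Ω n \ A n, (u n x) ^ 2) atTop (nhds 1) := by
  have key : ∀ n, ∫ x in A n, (u n x) ^ 2 ≤
      𝔠 * Λ * ((⨆ x ∈ A n, infDist x (Ω n)ᶜ) / (⨆ x ∈ Ω n, infDist x (Ω n)ᶜ)) ^ 2 := by
    intro n
    have hS := hdpos n
    have hle : ∀ x ∈ A n, infDist x (Ω n)ᶜ ≤ ⨆ x ∈ A n, infDist x (Ω n)ᶜ := by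
      intro x hx
      obtain ⟨M, hM⟩ := hdbdd n
      have hb : BddAbove (Set.range fun x => ⨆ (_ : x ∈ A n), infDist x (Ω n)ᶜ) := by
        refine ⟨max M 0, ?_⟩
        rintro _ ⟨y, rfl⟩
        by_cases hy : y ∈ A n
        · simp only [hy, ciSup_unique]
          exact le_max_of_le_left (hM ⟨y, hAΩ n hy, rfl⟩)
        · simp [hy]
      have := le_ciSup hb x
      simpa only [hx, ciSup_unique] using this
    set S := ⨆ x ∈ Ω n, infDist x (Ω n)ᶜ with hSdef
    set T := ⨆ x ∈ A n, infDist x (Ω n)ᶜ with hTdef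
    have hpos : ∀ x ∈ Ω n, 0 < infDist x (Ω n)ᶜ := by
      intro x hx
      have hne : ((Ω n)ᶜ).Nonempty := Set.nonempty_compl.2 (hΩproper n)
      exact ((hΩopen n).isClosed_compl.notMem_iff_infDist_pos hne).1 (fun h => h hx)
    have h1 : ∫ x in A n, (u n x) ^ 2 ≤
        ∫ x in A n, T ^ 2 * ((u n x) ^ 2 / (infDist x (Ω n)ᶜ) ^ 2) := by
      refine setIntegral_mono_on ((huint n).mono_set (hAΩ n))
        (((hhardyint n).mono_set (hAΩ n)).const_mul _) (hAmeas n) ?_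
      intro x hx
      have hp := hpos x (hAΩ n hx)
      have h2 : (infDist x (Ω n)ᶜ) ^ 2 ≤ T ^ 2 := pow_le_pow_left₀ hp.le (hle x hx) 2
      calc (u n x) ^ 2
          = (infDist x (Ω n)ᶜ) ^ 2 * ((u n x) ^ 2 / (infDist x (Ω n)ᶜ) ^ 2) := by
            field_simp
        _ ≤ _ := mul_le_mul_of_nonneg_right h2 (by positivity)
    rw [integral_const_mul] at h1
    have h3 : ∫ x in A n, (u n x) ^ 2 / (infDist x (Ω n)ᶜ) ^ 2 ≤
        ∫ x in Ω n, (u n x) ^ 2 / (infDist x (Ω n)ᶜ) ^ 2 :=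
      setIntegral_mono_set (hhardyint n) (ae_of_all _ fun x => by positivity)
        (hAΩ n).eventuallyLE
    have h4 : lam n ≤ Λ / S ^ 2 := (le_div_iff₀ (by positivity)).2 (heig n)
    calc _ ≤ _ := h1
      _ ≤ T ^ 2 * (𝔠 * (Λ / S ^ 2)) := by
        refine mul_le_mul_of_nonneg_left ((h3.trans (hhardy n)).trans ?_) (sq_nonneg T)
        exact mul_le_mul_of_nonneg_left h4 h𝔠.le
      _ = _ := by rw [div_pow]; ring
  have hA0 : Tendsto (fun n => ∫ x in A n, (u n x) ^ 2) atTop (nhds 0) := by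
    refine squeeze_zero (fun n => integral_nonneg fun x => sq_nonneg _) key ?_
    simpa using (hAd.pow 2).const_mul (𝔠 * Λ)
  refine ⟨hA0, ?_, ?_⟩
  · have h : ∀ n, (volume (Ω n \ A n)).toReal / (volume (Ω n)).toReal =
        1 - (volume (A n)).toReal / (volume (Ω n)).toReal := by
      intro n
      have hp := ENNReal.toReal_pos (hΩpos n).ne' (hΩfin n).ne
      have hAf : volume (A n) ≠ ⊤ := ((measure_mono (hAΩ n)).trans_lt (hΩfin n)).ne
      rw [measure_diff (hAΩ n) (hAmeas n).nullMeasurableSet hAf,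
        ENNReal.toReal_sub_of_le (measure_mono (hAΩ n)) (hΩfin n).ne, sub_div, div_self hp.ne']
    simp_rw [h]
    simpa using hAvol.const_sub 1
  · have h : ∀ n, ∫ x in Ω n \ A n, (u n x) ^ 2 = 1 - ∫ x in A n, (u n x) ^ 2 := by
      intro n
      rw [integral_diff (hAmeas n) (huint n) (hAΩ n), hnorm n]
    simp_rw [h]
    simpa using hA0.const_sub 1
end

section
/- Let 0 < α < 1, d > 0, and n ∈ ℕ with n ≥ 1 and d n^{-α} < 1. Let Q = (0,1) × (0,1) ⊂ ℝ², for i = 1, …, n−1 let L_i = {i/n} × [0, 1 − d n^{-α}] (a closed vertical line segment), and let Ω = Q \ ⋃_{i=1}^{n-1} L_i. Then every x = (x₁, x₂) ∈ Ω with x₂ ≤ 1 − d n^{-α} satisfies d_Ω(x) ≤ 1/(2n); consequently the Lebesgue measure of the set {x ∈ Ω : d_Ω(x) ≤ 1/(2n)} is at least 1 − d n^{-α}. -/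
open MeasureTheory Metric

/-- In the slit square `Ω_{n,α,d}`, every point below the top of the slits is at
distance at most `1/(2n)` from the boundary; hence
`|{d_Ω ≤ 1/(2n)}| ≥ 1 - d n^{-α}`. -/
theorem slit_square_small_distance
    (α d : ℝ) (hα0 : 0 < α) (hα1 : α < 1) (hd : 0 < d)
    (n : ℕ) (hn : 1 ≤ n) (hdn : d * (n : ℝ) ^ (-α) < 1)
    (Q : Set (EuclideanSpace ℝ (Fin 2)))
    (hQ : Q = {p | p 0 ∈ Set.Ioo (0 : ℝ) 1 ∧ p 1 ∈ Set.Ioo (0 : ℝ) 1})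
    (L : ℕ → Set (EuclideanSpace ℝ (Fin 2)))
    (hL : ∀ i, L i = {p | p 0 = (i : ℝ) / n
      ∧ p 1 ∈ Set.Icc (0 : ℝ) (1 - d * (n : ℝ) ^ (-α))})
    (Ω : Set (EuclideanSpace ℝ (Fin 2)))
    (hΩ : Ω = Q \ ⋃ i ∈ Finset.Ico 1 n, L i) :
    (∀ x ∈ Ω, x 1 ≤ 1 - d * (n : ℝ) ^ (-α) →
      infDist x Ωᶜ ≤ 1 / (2 * n)) ∧
    ENNReal.ofReal (1 - d * (n : ℝ) ^ (-α))
      ≤ volume {x ∈ Ω | infDist x Ωᶜ ≤ 1 / (2 * n)} := by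
  have hn0 : (0 : ℝ) < n := by exact_mod_cast hn
  set h : ℝ := 1 - d * (n : ℝ) ^ (-α) with hh
  have hpos : 0 < h := by rw [hh]; linarith
  have hlt : h < 1 := by
    have := mul_pos hd (Real.rpow_pos_of_pos hn0 (-α))
    rw [hh]; linarith
  have part1 : ∀ x ∈ Ω, x 1 ≤ h → infDist x Ωᶜ ≤ 1 / (2 * n) := by
    intro x hx hx1
    have hxQ : x ∈ Q := by rw [hΩ] at hx; exact hx.1
    rw [hQ] at hxQ
    obtain ⟨⟨h00, h01⟩, h10, h11⟩ := hxQ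
    set k : ℤ := round (n * x 0) with hk
    have hkr : |n * x 0 - k| ≤ 1 / 2 := abs_sub_round _
    set y : EuclideanSpace ℝ (Fin 2) := !₂[(k : ℝ) / n, x 1] with hy
    have y0 : y 0 = (k : ℝ) / n := by simp [hy]
    have y1 : y 1 = x 1 := by simp [hy]
    have hyc : y ∈ Ωᶜ := by
      intro hyΩ
      rw [hΩ] at hyΩ
      obtain ⟨hyQ, hyL⟩ := hyΩ
      rw [hQ] at hyQ
      obtain ⟨⟨a, b⟩, -⟩ := hyQ
      rw [y0] at a b
      have a' : 0 < k := by
        have := (div_pos_iff_of_pos_right hn0).1 a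
        exact_mod_cast this
      have b' : k < n := by
        have := (div_lt_one hn0).1 b
        exact_mod_cast this
      apply hyL
      lift k to ℕ using a'.le with m hm
      refine Set.mem_biUnion (x := m) ?_ ?_
      · simp only [Finset.coe_Ico, Set.mem_Ico]
        omega
      · rw [hL]
        refine ⟨by rw [y0]; simp, ?_⟩
        rw [y1]
        exact ⟨h10.le, hx1⟩
    refine (infDist_le_dist_of_mem hyc).trans ?_
    rw [EuclideanSpace.dist_eq, Fin.sum_univ_two, y0, y1, dist_self, Real.dist_eq]
    have e : x 0 - (k : ℝ) / n = (n * x 0 - k) / n := by field_simp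
    rw [e, abs_div, abs_of_pos hn0]
    simp only [ne_eq, OfNat.ofNat_ne_zero, not_false_eq_true, zero_pow, add_zero]
    rw [Real.sqrt_sq (by positivity), ← div_div]
    gcongr
  refine ⟨part1, ?_⟩
  set A : Set ℝ := Set.Ioo 0 1 \ Set.range (fun i : ℕ => (i : ℝ) / n) with hA
  have hc : (Set.range (fun i : ℕ => (i : ℝ) / n)).Countable := Set.countable_range _
  have hAv : volume A = 1 := by
    rw [hA, measure_sdiff_null (hc.measure_zero _)]
    simp
  have hAm : MeasurableSet A := measurableSet_Ioo.diff hc.measurableSet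
  set P : Set (Fin 2 → ℝ) := Set.pi Set.univ ![A, Set.Ioo 0 h] with hP
  have hPm : MeasurableSet P := by
    refine MeasurableSet.univ_pi fun i => ?_
    fin_cases i
    · exact hAm
    · exact measurableSet_Ioo
  have hPv : volume P = ENNReal.ofReal h := by
    rw [hP, volume_pi_pi, Fin.prod_univ_two]
    simp [hAv]
  rw [← hPv, ← (PiLp.volume_preserving_ofLp (Fin 2)).measure_preimage hPm.nullMeasurableSet]
  apply measure_mono
  intro x hx
  have hx0 : x 0 ∈ A := hx 0 trivial
  have hx1 : x 1 ∈ Set.Ioo 0 h := hx 1 trivial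
  have hxΩ : x ∈ Ω := by
    rw [hΩ, hQ]
    refine ⟨⟨hx0.1, hx1.1, hx1.2.trans hlt⟩, fun hu => ?_⟩
    obtain ⟨i, -, hi⟩ := Set.mem_iUnion₂.1 hu
    rw [hL] at hi
    exact hx0.2 ⟨i, hi.1.symm⟩
  exact ⟨hxΩ, part1 x hxΩ hx1.2.le⟩
end
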